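/- For every f ∈ P and all positive integers i, j the following commutation relations hold: (a) if i ≥ j then T_i(R_j f) = R_j(T_{i+1} f); (b) if i > j then R_i(T_j f) = T_j(R_{i+1} f); (c) if i ≥ j then R_i(R_j f) = R_j(R_{i+1} f). -/

import Mathlib

/-!
Statement 1. With `P = ℤ[x₁, x₂, …]` (variables indexed by positive integers),
the Bergeron–Sottile maps `R_i` and the quasisymmetric divided differences `T_i`
(characterized by `x_i · (T_i f) = R_{i+1} f − R_i f`) satisfy:
(a) `T_i R_j = R_j T_{i+1}` for `i ≥ j`;
(b) `R_i T_j = T_j R_{i+1}` for `i > j`;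
(c) `R_i R_j = R_j R_{i+1}` for `i ≥ j`.
-/

/-- The polynomial ring `ℤ[x₁, x₂, …]` with variables indexed by the positive integers. -/
abbrev PolyP : Type := MvPolynomial ℕ+ ℤ

/-- The Bergeron–Sottile map `R_i : P → P`,
`f(x₁, x₂, …) ↦ f(x₁, …, x_{i−1}, 0, x_i, x_{i+1}, …)`. -/
noncomputable def Rop (i : ℕ+) : PolyP →ₐ[ℤ] PolyP :=
  MvPolynomial.aeval (fun j : ℕ+ =>
    if j < i then MvPolynomial.X j
    else if j = i then 0
    else MvPolynomial.X (j - 1))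

theorem Rop_X_of_lt {i k : ℕ+} (h : k < i) : Rop i (MvPolynomial.X k) = MvPolynomial.X k := by
  simp [Rop, h]

theorem Rop_X_self (i : ℕ+) : Rop i (MvPolynomial.X i) = 0 := by
  simp [Rop]

theorem Rop_X_add_one_of_le {i k : ℕ+} (h : i ≤ k) :
    Rop i (MvPolynomial.X (k + 1)) = MvPolynomial.X k := by
  have h₁ : i < k + 1 := PNat.lt_add_one_iff.mpr h
  simp [Rop, h₁.not_gt, h₁.ne', PNat.add_sub]

theorem Rop_Rop_of_le {i j : ℕ+} (h : j ≤ i) (f : PolyP) :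
    Rop i (Rop j f) = Rop j (Rop (i + 1) f) := by
  suffices H : (Rop i).comp (Rop j) = (Rop j).comp (Rop (i + 1)) from DFunLike.congr_fun H f
  refine MvPolynomial.algHom_ext fun k => ?_
  simp only [AlgHom.comp_apply]
  rcases lt_trichotomy k j with hkj | rfl | hjk
  · rw [Rop_X_of_lt hkj, Rop_X_of_lt (hkj.trans_le h),
      Rop_X_of_lt ((hkj.trans_le h).trans (PNat.lt_add_right i 1)), Rop_X_of_lt hkj]
  · rw [Rop_X_self, Rop_X_of_lt (PNat.lt_add_one_iff.mpr h), Rop_X_self, map_zero]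
  · obtain ⟨m, rfl⟩ := PNat.exists_eq_succ_of_ne_one (ne_bot_of_gt hjk)
    have hjm : j ≤ m := PNat.lt_add_one_iff.mp hjk
    rw [Rop_X_add_one_of_le hjm]
    rcases lt_trichotomy m i with hmi | rfl | him
    · rw [Rop_X_of_lt hmi, Rop_X_of_lt (add_lt_add_left hmi 1), Rop_X_add_one_of_le hjm]
    · rw [Rop_X_self, Rop_X_self, map_zero]
    · obtain ⟨n, rfl⟩ := PNat.exists_eq_succ_of_ne_one (ne_bot_of_gt him)
      have hin : i ≤ n := PNat.lt_add_one_iff.mp him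
      rw [Rop_X_add_one_of_le hin, Rop_X_add_one_of_le (PNat.add_one_le_iff.mpr him),
        Rop_X_add_one_of_le (h.trans hin)]

theorem stmt1 (T : ℕ+ → (PolyP →ₗ[ℤ] PolyP))
    (hT : ∀ (i : ℕ+) (f : PolyP),
      (MvPolynomial.X i : PolyP) * T i f = Rop (i + 1) f - Rop i f)
    (f : PolyP) (i j : ℕ+) :
    (i ≥ j → T i (Rop j f) = Rop j (T (i + 1) f)) ∧
    (i > j → Rop i (T j f) = T j (Rop (i + 1) f)) ∧
    (i ≥ j → Rop i (Rop j f) = Rop j (Rop (i + 1) f)) := by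
  refine ⟨fun h => ?_, fun h => ?_, fun h => Rop_Rop_of_le h f⟩
  · refine mul_left_cancel₀ (MvPolynomial.X_ne_zero i) ?_
    calc MvPolynomial.X i * T i (Rop j f)
        = Rop j (Rop (i + 1 + 1) f - Rop (i + 1) f) := by
          rw [hT, map_sub, Rop_Rop_of_le h, Rop_Rop_of_le (h.le.trans (PNat.lt_add_right i 1).le)]
      _ = MvPolynomial.X i * Rop j (T (i + 1) f) := by
          rw [← hT, map_mul, Rop_X_add_one_of_le h]
  · refine mul_left_cancel₀ (MvPolynomial.X_ne_zero j) ?_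
    calc MvPolynomial.X j * Rop i (T j f)
        = Rop i (Rop (j + 1) f - Rop j f) := by
          rw [← hT, map_mul, Rop_X_of_lt h]
      _ = MvPolynomial.X j * T j (Rop (i + 1) f) := by
          rw [hT, map_sub, Rop_Rop_of_le h.le, Rop_Rop_of_le (PNat.add_one_le_iff.mpr h)]
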